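/- Let X ⊆ ℝ^d be a finite set of points partitioned into K nonempty clusters C*_1, …, C*_K, and let φ*_K(X) = Σ_{i=1}^K Σ_{x∈C*_i} ‖x − c(C*_i)‖² denote the potential of this partition, where c(A) = (1/|A|) Σ_{x∈A} x is the centroid of a finite set A. Let ε, δ ∈ (0, 1], and for each i let S_i be a uniformly random m_i-element subset of C*_i with 1 ≤ m_i ≤ |C*_i| and m_i ≥ K/(δε), the subsets S_1, …, S_K being drawn independently. Then with probability at least 1 − δ, Σ_{i=1}^K Σ_{x∈C*_i} ‖x − c(S_i)‖² ≤ (1 + ε) · φ*_K(X). -/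

import Mathlib

open Finset
open scoped Classical

/-- The centroid `c(A) = (1/|A|) ∑_{x ∈ A} x` of a finite set of points in `ℝ^d`. -/
noncomputable def centroid {d : ℕ} (A : Finset (EuclideanSpace ℝ (Fin d))) :
    EuclideanSpace ℝ (Fin d) :=
  (A.card : ℝ)⁻¹ • ∑ x ∈ A, x

section SamplingWithoutReplacement

variable {ι E : Type*} [NormedAddCommGroup E] [InnerProductSpace ℝ E]

/-- Without replacement, the inclusion indicators of two distinct points are exchangeable, so for a
family of vectors with zero sum the second moment of the sample sum is bounded by its diagonal. -/
theorem sum_powersetCard_norm_sum_sq_le (C : Finset ι) (v : ι → E) (hv : ∑ x ∈ C, v x = 0)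
    {m : ℕ} (hm : 1 ≤ m) :
    ∑ S ∈ C.powersetCard m, ‖∑ x ∈ S, v x‖ ^ 2 ≤
      ((C.card - 1).choose (m - 1) : ℝ) * ∑ x ∈ C, ‖v x‖ ^ 2 := by
  set p : ℝ := ((C.card - 1).choose (m - 1) : ℝ) with hp
  set q : ℝ := if 2 ≤ m then ((C.card - 2).choose (m - 2) : ℝ) else 0 with hq
  have hq0 : 0 ≤ q := by rw [hq]; split_ifs <;> positivity
  have count_pair : ∀ x ∈ C, ∀ y ∈ C,
      (((C.powersetCard m).filter (fun S => x ∈ S ∧ y ∈ S)).card : ℝ) =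
        q + if x = y then p - q else 0 := by
    intro x hx y hy
    have hsub : (C.powersetCard m).filter (fun S => x ∈ S ∧ y ∈ S) =
        (C.powersetCard m).filter (fun S => ({x, y} : Finset ι) ⊆ S) := by
      refine filter_congr fun S _ => ?_
      simp [insert_subset_iff]
    have hxy : ({x, y} : Finset ι) ⊆ C := by simp [insert_subset_iff, hx, hy]
    rw [hsub]
    by_cases h : x = y
    · subst h
      rw [card_filter_powersetCard_subset _ _ _ hxy (by simpa using hm)]
      simp [hp]
    · have hcard : ({x, y} : Finset ι).card = 2 := card_pair h
      by_cases h2 : 2 ≤ m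
      · rw [card_filter_powersetCard_subset _ _ _ hxy (by rwa [hcard]), hcard]
        simp [hq, h, h2]
      · rw [filter_eq_empty_iff.2]
        · simp [hq, h, h2]
        · intro S hS hsubS
          have := card_le_card hsubS
          rw [(mem_powersetCard.1 hS).2, hcard] at this
          exact h2 this
  have expand : ∀ S ∈ C.powersetCard m, ‖∑ x ∈ S, v x‖ ^ 2 =
      ∑ x ∈ C, ∑ y ∈ C, if x ∈ S ∧ y ∈ S then inner ℝ (v x) (v y) else 0 := by
    intro S hS
    have hSC := (mem_powersetCard.1 hS).1
    rw [← real_inner_self_eq_norm_sq, sum_inner, ← inter_eq_right.2 hSC, ← sum_ite_mem]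
    refine sum_congr rfl fun x _ => ?_
    rw [inter_eq_right.2 hSC, inner_sum]
    split_ifs with h
    · nth_rw 1 [← inter_eq_right.2 hSC]
      rw [← sum_ite_mem]
      simp [h]
    · simp [h]
  have hzero : ∑ x ∈ C, ∑ y ∈ C, inner ℝ (v x) (v y) = 0 := by
    simp_rw [← inner_sum, hv, inner_zero_right, sum_const_zero]
  calc ∑ S ∈ C.powersetCard m, ‖∑ x ∈ S, v x‖ ^ 2
      = ∑ x ∈ C, ∑ y ∈ C, (q + if x = y then p - q else 0) * inner ℝ (v x) (v y) := by
        rw [sum_congr rfl expand, sum_comm]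
        refine sum_congr rfl fun x hx => ?_
        rw [sum_comm]
        refine sum_congr rfl fun y hy => ?_
        rw [← count_pair x hx y hy, ← sum_filter, sum_const, nsmul_eq_mul]
    _ = q * ∑ x ∈ C, ∑ y ∈ C, inner ℝ (v x) (v y) + (p - q) * ∑ x ∈ C, ‖v x‖ ^ 2 := by
        simp_rw [add_mul, sum_add_distrib, mul_sum, ite_mul, zero_mul]
        congr 1
        refine sum_congr rfl fun x hx => ?_
        rw [sum_ite_eq, if_pos hx, real_inner_self_eq_norm_sq]
    _ ≤ p * ∑ x ∈ C, ‖v x‖ ^ 2 := by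
        rw [hzero, mul_zero, zero_add]
        exact mul_le_mul_of_nonneg_right (by linarith) (sum_nonneg fun _ _ => by positivity)

end SamplingWithoutReplacement

/-- A bound on the mean of `f` over one factor is a bound on the mean over the product. -/
theorem sum_piFinset_apply_le {ι : Type*} [Fintype ι] [DecidableEq ι] {α : ι → Type*}
    (P : ∀ i, Finset (α i)) (i : ι) (f : α i → ℝ) (b : ℝ)
    (h : ∑ s ∈ P i, f s ≤ ((P i).card : ℝ) * b) :
    ∑ S ∈ Fintype.piFinset P, f (S i) ≤ ((Fintype.piFinset P).card : ℝ) * b := by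
  have hmaps : ∀ S ∈ Fintype.piFinset P, S i ∈ P i := fun S hS => Fintype.mem_piFinset.1 hS i
  have hsum : ∑ S ∈ Fintype.piFinset P, f (S i) =
      (∏ j ∈ univ.erase i, ((P j).card : ℝ)) * ∑ s ∈ P i, f s := by
    rw [← sum_fiberwise_of_maps_to hmaps, mul_sum]
    refine sum_congr rfl fun a ha => ?_
    rw [sum_congr rfl (g := fun _ => f a) fun S hS => by rw [(mem_filter.1 hS).2],
      sum_const, nsmul_eq_mul, Fintype.card_filter_piFinset_eq_of_mem P i ha, Nat.cast_prod]
  rw [hsum, Fintype.card_piFinset, Nat.cast_prod, ← prod_erase_mul _ _ (mem_univ i), mul_assoc]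
  exact mul_le_mul_of_nonneg_left h (prod_nonneg fun _ _ => Nat.cast_nonneg _)

theorem sum_sub_centroid {d : ℕ} {A : Finset (EuclideanSpace ℝ (Fin d))} (hA : A.Nonempty) :
    ∑ x ∈ A, (x - centroid A) = 0 := by
  have : (A.card : ℝ) ≠ 0 := by exact_mod_cast hA.card_pos.ne'
  rw [sum_sub_distrib, sum_const, ← Nat.cast_smul_eq_nsmul ℝ, _root_.centroid, smul_smul,
    mul_inv_cancel₀ this, one_smul, sub_self]

/-- The parallel axis identity. -/
theorem sum_norm_sub_sq_eq {d : ℕ} {A : Finset (EuclideanSpace ℝ (Fin d))} (hA : A.Nonempty)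
    (z : EuclideanSpace ℝ (Fin d)) :
    ∑ x ∈ A, ‖x - z‖ ^ 2 =
      ∑ x ∈ A, ‖x - centroid A‖ ^ 2 + (A.card : ℝ) * ‖z - centroid A‖ ^ 2 := by
  have key : ∀ x ∈ A, ‖x - z‖ ^ 2 = ‖x - centroid A‖ ^ 2
      - 2 * inner ℝ (x - centroid A) (z - centroid A) + ‖z - centroid A‖ ^ 2 := by
    intro x _
    rw [← norm_sub_sq_real, sub_sub_sub_cancel_right]
  rw [sum_congr rfl key, sum_add_distrib, sum_sub_distrib, ← mul_sum, ← sum_inner,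
    sum_sub_centroid hA, inner_zero_left, sum_const, nsmul_eq_mul]
  ring

/-- Inaba's second-moment bound for sampling without replacement: the mean excess cost of the
sample centroid is at most `1 / m` times the optimal cost. -/
theorem sum_powersetCard_centroid_le {d : ℕ} {A : Finset (EuclideanSpace ℝ (Fin d))}
    (hA : A.Nonempty) {m : ℕ} (hm : 1 ≤ m) :
    ∑ S ∈ A.powersetCard m, (A.card : ℝ) * ‖centroid S - centroid A‖ ^ 2 ≤
      ((A.powersetCard m).card : ℝ) * ((∑ x ∈ A, ‖x - centroid A‖ ^ 2) / m) := by
  have hm0 : (m : ℝ) ≠ 0 := by exact_mod_cast (by omega : m ≠ 0)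
  have hS : ∀ S ∈ A.powersetCard m, (A.card : ℝ) * ‖centroid S - centroid A‖ ^ 2 =
      (A.card : ℝ) / m ^ 2 * ‖∑ x ∈ S, (x - centroid A)‖ ^ 2 := by
    intro S hS
    have hcard := (mem_powersetCard.1 hS).2
    have : centroid S - centroid A = (m : ℝ)⁻¹ • ∑ x ∈ S, (x - centroid A) := by
      rw [sum_sub_distrib, sum_const, ← Nat.cast_smul_eq_nsmul ℝ, hcard, smul_sub, smul_smul,
        inv_mul_cancel₀ hm0, one_smul, _root_.centroid, hcard]
    rw [this, norm_smul, mul_pow, norm_inv, Real.norm_natCast]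
    ring
  have hchoose : (A.card : ℝ) * ((A.card - 1).choose (m - 1) : ℝ) = (A.card.choose m : ℝ) * m := by
    have := Nat.add_one_mul_choose_eq (A.card - 1) (m - 1)
    rw [Nat.sub_add_cancel hA.card_pos, Nat.sub_add_cancel hm] at this
    exact_mod_cast this
  rw [sum_congr rfl hS, ← mul_sum, card_powersetCard]
  calc (A.card : ℝ) / m ^ 2 * ∑ S ∈ A.powersetCard m, ‖∑ x ∈ S, (x - centroid A)‖ ^ 2
      ≤ (A.card : ℝ) / m ^ 2 *
          (((A.card - 1).choose (m - 1) : ℝ) * ∑ x ∈ A, ‖x - centroid A‖ ^ 2) :=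
        mul_le_mul_of_nonneg_left
          (sum_powersetCard_norm_sum_sq_le A (fun x => x - centroid A) (sum_sub_centroid hA) hm)
          (by positivity)
    _ = ((A.card : ℝ) * ((A.card - 1).choose (m - 1) : ℝ)) / m ^ 2 *
          ∑ x ∈ A, ‖x - centroid A‖ ^ 2 := by ring
    _ = (A.card.choose m : ℝ) * ((∑ x ∈ A, ‖x - centroid A‖ ^ 2) / m) := by
        rw [hchoose]
        field_simp

/-- Markov's inequality for the uniform distribution on a finite set, in a form that remains valid
when the threshold `t` is zero. -/
theorem one_sub_mul_card_le_card_filter {α : Type*} (P : Finset α) (g : α → ℝ)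
    (hg : ∀ a ∈ P, 0 ≤ g a) {t δ : ℝ} (ht : 0 ≤ t) (hδ : 0 ≤ δ)
    (h : ∑ a ∈ P, g a ≤ (P.card : ℝ) * (δ * t)) :
    (1 - δ) * (P.card : ℝ) ≤ ((P.filter (fun a => g a ≤ t)).card : ℝ) := by
  have hcard : ((P.filter (fun a => g a ≤ t)).card : ℝ) +
      ((P.filter (fun a => ¬ g a ≤ t)).card : ℝ) = P.card := by
    exact_mod_cast card_filter_add_card_filter_not (s := P) (fun a => g a ≤ t)
  rcases ht.eq_or_lt with rfl | ht
  · have hzero : ∑ a ∈ P, g a = 0 := le_antisymm (by simpa using h) (sum_nonneg hg)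
    rw [filter_true_of_mem fun a ha => ((sum_eq_zero_iff_of_nonneg hg).1 hzero a ha).le]
    nlinarith [Nat.cast_nonneg (α := ℝ) P.card]
  · have hbad : ((P.filter (fun a => ¬ g a ≤ t)).card : ℝ) * t ≤ ∑ a ∈ P, g a := by
      rw [← nsmul_eq_mul]
      refine (card_nsmul_le_sum _ g t fun a ha => (not_le.1 (mem_filter.1 ha).2).le).trans ?_
      exact sum_le_sum_of_subset_of_nonneg (filter_subset _ _) fun a ha _ => hg a ha
    have : ((P.filter (fun a => ¬ g a ≤ t)).card : ℝ) ≤ P.card * δ :=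
      le_of_mul_le_mul_right (by linarith) ht
    linarith

/-- Phase 2 guarantee: let `X ⊆ ℝ^d` be a finite set partitioned into `K` nonempty
clusters `C*₁, …, C*_K` with potential `φ*_K(X) = ∑ᵢ ∑_{x∈C*ᵢ} ‖x − c(C*ᵢ)‖²`. For
`ε, δ ∈ (0,1]`, let each `Sᵢ` be an independent uniformly random `mᵢ`-element subset of
`C*ᵢ` with `1 ≤ mᵢ ≤ |C*ᵢ|` and `mᵢ ≥ K/(δε)`. Then with probability at least `1 − δ`,
`∑ᵢ ∑_{x∈C*ᵢ} ‖x − c(Sᵢ)‖² ≤ (1 + ε)·φ*_K(X)`.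
The probability is expressed by counting tuples `(S₁, …, S_K)` in the product of the
families of `mᵢ`-subsets of the clusters. -/
theorem phase_two_guarantee {d K : ℕ} (hK : 1 ≤ K)
    (X : Finset (EuclideanSpace ℝ (Fin d)))
    (C : Fin K → Finset (EuclideanSpace ℝ (Fin d)))
    (hdisj : ∀ i j, i ≠ j → Disjoint (C i) (C j))
    (hunion : ∀ x, x ∈ X ↔ ∃ i, x ∈ C i)
    (hne : ∀ i, (C i).Nonempty)
    (ε δ : ℝ) (hε0 : 0 < ε) (hε1 : ε ≤ 1) (hδ0 : 0 < δ) (hδ1 : δ ≤ 1)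
    (m : Fin K → ℕ) (hm1 : ∀ i, 1 ≤ m i) (hm2 : ∀ i, m i ≤ (C i).card)
    (hm3 : ∀ i, (K : ℝ) / (δ * ε) ≤ (m i : ℝ)) :
    (1 - δ) * ((Fintype.piFinset (fun i => (C i).powersetCard (m i))).card : ℝ) ≤
      (((Fintype.piFinset (fun i => (C i).powersetCard (m i))).filter
          (fun S : Fin K → Finset (EuclideanSpace ℝ (Fin d)) =>
            ∑ i, ∑ x ∈ C i, ‖x - centroid (S i)‖ ^ 2 ≤
              (1 + ε) * ∑ i, ∑ x ∈ C i, ‖x - centroid (C i)‖ ^ 2)).card : ℝ) := by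
  have hδε : 0 < δ * ε := mul_pos hδ0 hε0
  set φ : Fin K → ℝ := fun i => ∑ x ∈ C i, ‖x - centroid (C i)‖ ^ 2 with hφ
  have hφ0 : ∀ i, 0 ≤ φ i := fun i => sum_nonneg fun _ _ => by positivity
  have hcost : ∀ S : Fin K → Finset (EuclideanSpace ℝ (Fin d)),
      ∑ i, ∑ x ∈ C i, ‖x - centroid (S i)‖ ^ 2 =
        ∑ i, φ i + ∑ i, ((C i).card : ℝ) * ‖centroid (S i) - centroid (C i)‖ ^ 2 := by
    intro S
    rw [← sum_add_distrib]
    exact sum_congr rfl fun i _ => sum_norm_sub_sq_eq (hne i) _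
  have hdiv : ∀ i, φ i / m i ≤ δ * ε * φ i := by
    intro i
    have hmpos : (0 : ℝ) < m i := by exact_mod_cast hm1 i
    have hK' : (1 : ℝ) ≤ K := by exact_mod_cast hK
    have h1 : 1 ≤ m i * (δ * ε) := hK'.trans ((div_le_iff₀ hδε).1 (hm3 i))
    rw [div_le_iff₀ hmpos]
    nlinarith [hφ0 i]
  have hmean : ∑ S ∈ Fintype.piFinset (fun i => (C i).powersetCard (m i)),
      ∑ i, ((C i).card : ℝ) * ‖centroid (S i) - centroid (C i)‖ ^ 2 ≤
        ((Fintype.piFinset (fun i => (C i).powersetCard (m i))).card : ℝ) *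
          (δ * (ε * ∑ i, φ i)) := by
    rw [sum_comm, ← mul_assoc δ, mul_sum, mul_sum]
    refine sum_le_sum fun i _ => ?_
    refine (sum_piFinset_apply_le (fun i => (C i).powersetCard (m i)) i
      (fun s => ((C i).card : ℝ) * ‖centroid s - centroid (C i)‖ ^ 2) _
      (sum_powersetCard_centroid_le (hne i) (hm1 i))).trans ?_
    exact mul_le_mul_of_nonneg_left (hdiv i) (Nat.cast_nonneg _)
  have hmarkov := one_sub_mul_card_le_card_filter _ _
    (fun S _ => sum_nonneg fun i _ => mul_nonneg (Nat.cast_nonneg _) (sq_nonneg _))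
    (mul_nonneg hε0.le (sum_nonneg fun i _ => hφ0 i)) hδ0.le hmean
  refine hmarkov.trans (Nat.cast_le.2 (card_le_card (monotone_filter_right _ fun S _ hS => ?_)))
  rw [hcost, add_mul, one_mul]
  gcongr
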